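/- If p ∈ Q(H)^{sym} and e_λ(p) is even for every self-dual irreducible λ ∈ ℤ[H], then p ∈ A(H)N(H). (Injectivity of the total homomorphism Ψ in Proposition 5.1(1).) -/

import Mathlib

noncomputable section
open scoped nonZeroDivisors

/-- `H = H₁(Σ_{g,n}) ≅ ℤ^{n-1+2g}`, written as `H_∂ × Ĥ` with `Ĥ` carrying the
symplectic structure (two `Fin g` blocks). -/
abbrev SurfH (g n : ℕ) : Type := (Fin (n - 1) → ℤ) × ((Fin g → ℤ) × (Fin g → ℤ))

/-- The integral group ring `ℤ[H]`. -/
abbrev GR (g n : ℕ) : Type := AddMonoidAlgebra ℤ (SurfH g n)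

instance (g n : ℕ) : IsDomain (GR g n) := NoZeroDivisors.to_isDomain _

/-- The quotient field `Q(H)` of `ℤ[H]`. -/
abbrev QF (g n : ℕ) : Type := FractionRing (GR g n)

/-- The inclusion `ℤ[H] → Q(H)`. -/
abbrev incl (g n : ℕ) : GR g n →+* QF g n := algebraMap (GR g n) (QF g n)

/-- The standard symplectic form on `Ĥ = ℤ^{2g}`. -/
def symplForm {g : ℕ} (v w : (Fin g → ℤ) × (Fin g → ℤ)) : ℤ :=
  (∑ i, v.1 i * w.2 i) - ∑ i, v.2 i * w.1 i

/-- `Aut*(H)`: automorphisms of `H` fixing `H_∂` pointwise and with block form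
`[[I, *], [0, P₀]]`, `P₀ ∈ Sp(2g, ℤ)`. -/
def AutStar (g n : ℕ) : Set (SurfH g n ≃+ SurfH g n) :=
  {φ | (∀ x : Fin (n - 1) → ℤ, φ (x, 0) = (x, 0)) ∧
       ∀ v w : (Fin g → ℤ) × (Fin g → ℤ),
         symplForm (φ (0, v)).2 (φ (0, w)).2 = symplForm v w}

/-- The ring automorphism of `ℤ[H]` induced by an automorphism of `H`. -/
def ringAut {g n : ℕ} (φ : SurfH g n ≃+ SurfH g n) : GR g n ≃+* GR g n :=
  (AddMonoidAlgebra.domCongr ℤ ℤ φ).toRingEquiv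

/-- The field automorphism of `Q(H)` induced by a ring automorphism of `ℤ[H]`. -/
def fieldAut {g n : ℕ} (e : GR g n ≃+* GR g n) : QF g n ≃+* QF g n :=
  IsFractionRing.ringEquivOfRingEquiv e

/-- The involution `p ↦ p̄` of `ℤ[H]`, induced by `h ↦ h⁻¹`. -/
def barR (g n : ℕ) : GR g n ≃+* GR g n := ringAut (AddEquiv.neg (SurfH g n))

/-- The involution `p ↦ p̄` of `Q(H)`. -/
def barQ (g n : ℕ) : QF g n ≃+* QF g n := fieldAut (barR g n)

/-- `p ≐ q`: `p = ±h·q` for some `h ∈ H`. -/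
def doteq {g n : ℕ} (p q : QF g n) : Prop :=
  ∃ (u : ℤˣ) (h : SurfH g n), p = incl g n (AddMonoidAlgebra.single h (u : ℤ)) * q

/-- `p ∼ q`: `p ≐ φ(q)` for some `φ ∈ Aut*(H)`. -/
def sim (g n : ℕ) (p q : QF g n) : Prop :=
  ∃ φ ∈ AutStar g n, doteq p (fieldAut (ringAut φ) q)

/-- The subgroup `A(H)` of `Q(H)^×` generated by all `±h·p⁻¹·φ(p)`. -/
def AH (g n : ℕ) : Subgroup (QF g n)ˣ :=
  Subgroup.closure {x : (QF g n)ˣ |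
    ∃ (u : ℤˣ) (h : SurfH g n) (p : (QF g n)ˣ) (φ : SurfH g n ≃+ SurfH g n),
      φ ∈ AutStar g n ∧
      (x : QF g n) = incl g n (AddMonoidAlgebra.single h (u : ℤ)) * (↑p)⁻¹ *
        fieldAut (ringAut φ) ↑p}

/-- The subgroup `N(H) = {±h·q·q̄}` of `Q(H)^×`. -/
def NH (g n : ℕ) : Subgroup (QF g n)ˣ :=
  Subgroup.closure {x : (QF g n)ˣ |
    ∃ (u : ℤˣ) (h : SurfH g n) (q : (QF g n)ˣ),
      (x : QF g n) = incl g n (AddMonoidAlgebra.single h (u : ℤ)) * ↑q * barQ g n ↑q}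

/-- The involution on `Q(H)^×` as a group homomorphism. -/
def barU (g n : ℕ) : (QF g n)ˣ →* (QF g n)ˣ :=
  Units.map (barQ g n).toRingHom.toMonoidHom

/-- `Q(H)^{sym} = {p : p·A(H) = p̄·A(H)}`. -/
def Qsym (g n : ℕ) : Subgroup (QF g n)ˣ :=
  (AH g n).comap (barU g n / MonoidHom.id (QF g n)ˣ)

open UniqueFactorizationMonoid in
/-- For irreducible `l`, the number of irreducible factors (with multiplicity) of
`r ∈ ℤ[H]` lying in the `∼`-class of `l`; this is `e_l` on `ℤ[H]`. -/
def eCount (g n : ℕ) [UniqueFactorizationMonoid (GR g n)] (l r : GR g n) : ℕ :=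
  Multiset.card (@Multiset.filter _
    (fun m => sim g n (incl g n m) (incl g n l)) (Classical.decPred _) (factors r))

/-- `e_l(p)` for `p ∈ Q(H)^×`, via a choice of fraction representation. -/
def eOrb (g n : ℕ) [UniqueFactorizationMonoid (GR g n)] (l : GR g n) (p : QF g n) : ℤ :=
  (eCount g n l (IsLocalization.sec (GR g n)⁰ p).1 : ℤ) -
    (eCount g n l ((IsLocalization.sec (GR g n)⁰ p).2 : GR g n) : ℤ)

open UniqueFactorizationMonoid

/-- Units of the group ring of a group with two unique sums over a domain are trivial. -/
theorem AddMonoidAlgebra.exists_eq_single_of_isUnit {R G : Type*} [CommRing R] [IsDomain R]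
    [AddCommGroup G] [TwoUniqueSums G] {a : AddMonoidAlgebra R G} (ha : IsUnit a) :
    ∃ (u : Rˣ) (h : G), a = single h (u : R) := by
  classical
  obtain ⟨b, hab⟩ := ha.exists_right_inv
  have hzero : ∀ x ∈ a.coeff.support, ∀ y ∈ b.coeff.support,
      UniqueAdd a.coeff.support b.coeff.support x y → x + y = 0 := by
    intro x hx y hy hxy
    by_contra hne
    have h1 := coeff_mul_add_of_uniqueAdd hxy
    rw [hab, one_def, coeff_single, Finsupp.single_apply, if_neg (Ne.symm hne)] at h1
    exact mul_ne_zero (Finsupp.mem_support_iff.mp hx) (Finsupp.mem_support_iff.mp hy) h1.symm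
  have hcard : a.coeff.support.card * b.coeff.support.card ≤ 1 := by
    by_contra! hlt
    obtain ⟨p, hp, q, hq, hpq, hup, huq⟩ := TwoUniqueSums.uniqueAdd_of_one_lt_card hlt
    rw [Finset.mem_product] at hp hq
    have h1 := hzero _ hp.1 _ hp.2 hup
    have h2 := hzero _ hq.1 _ hq.2 huq
    obtain ⟨h3, h4⟩ := hup hq.1 hq.2 (h2.trans h1.symm)
    exact hpq (Prod.ext h3.symm h4.symm)
  have hne : ∀ c : AddMonoidAlgebra R G, c ≠ 0 → c.coeff.support.card ≠ 0 := by
    intro c hc h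
    exact hc (coeff_eq_zero.mp (Finsupp.support_eq_empty.mp (Finset.card_eq_zero.mp h)))
  have hab0 : a * b ≠ 0 := by rw [hab]; exact one_ne_zero
  have ha1 := hne a (left_ne_zero_of_mul hab0)
  have hb1 := hne b (right_ne_zero_of_mul hab0)
  have hsupp : ∀ c : AddMonoidAlgebra R G, c.coeff.support.card = 1 →
      ∃ (h : G) (r : R), c = single h r := by
    intro c hc
    obtain ⟨h, r, -, hr⟩ := Finsupp.card_support_eq_one'.mp hc
    exact ⟨h, r, coeff_injective hr⟩
  obtain ⟨h, r, rfl⟩ := hsupp a (by nlinarith [Nat.pos_of_ne_zero ha1, Nat.pos_of_ne_zero hb1])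
  obtain ⟨k, s, rfl⟩ := hsupp b (by nlinarith [Nat.pos_of_ne_zero ha1, Nat.pos_of_ne_zero hb1])
  rw [single_mul_single, one_def] at hab
  have hrs : r * s = 1 := by
    have h1 := congrArg (fun c : AddMonoidAlgebra R G => c.coeff 0) hab
    simp only [coeff_single, Finsupp.single_apply, if_true] at h1
    split_ifs at h1
    · exact h1
    · exact absurd h1.symm one_ne_zero
  exact ⟨Units.mkOfMulEqOne r s hrs, h, rfl⟩

section AutStar

variable {g n : ℕ}

theorem isUnit_single (u : ℤˣ) (h : SurfH g n) :
    IsUnit (AddMonoidAlgebra.single h (u : ℤ) : GR g n) := by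
  refine IsUnit.of_mul_eq_one (AddMonoidAlgebra.single (-h) ((u⁻¹ : ℤˣ) : ℤ)) ?_
  rw [AddMonoidAlgebra.single_mul_single, AddMonoidAlgebra.one_def]
  simp

theorem snd_apply_of_mem_autStar {φ : SurfH g n ≃+ SurfH g n} (hφ : φ ∈ AutStar g n)
    (z : SurfH g n) : (φ z).2 = (φ (0, z.2)).2 := by
  have h : z = (z.1, 0) + (0, z.2) := by simp
  conv_lhs => rw [h, map_add, hφ.1]
  simp

theorem mem_autStar_iff {φ : SurfH g n ≃+ SurfH g n} :
    φ ∈ AutStar g n ↔ (∀ x, φ (x, 0) = (x, 0)) ∧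
      ∀ z w, symplForm (φ z).2 (φ w).2 = symplForm z.2 w.2 := by
  refine ⟨fun h => ⟨h.1, fun z w => ?_⟩, fun h => ⟨h.1, fun v w => h.2 _ _⟩⟩
  rw [snd_apply_of_mem_autStar h z, snd_apply_of_mem_autStar h w, h.2]

theorem refl_mem_autStar : AddEquiv.refl (SurfH g n) ∈ AutStar g n :=
  ⟨fun _ => rfl, fun _ _ => rfl⟩

theorem symm_mem_autStar {φ : SurfH g n ≃+ SurfH g n} (hφ : φ ∈ AutStar g n) :
    φ.symm ∈ AutStar g n := by
  rw [mem_autStar_iff] at hφ ⊢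
  refine ⟨fun x => ?_, fun z w => ?_⟩
  · rw [AddEquiv.symm_apply_eq, hφ.1]
  · rw [← hφ.2, φ.apply_symm_apply, φ.apply_symm_apply]

theorem trans_mem_autStar {φ ψ : SurfH g n ≃+ SurfH g n} (hφ : φ ∈ AutStar g n)
    (hψ : ψ ∈ AutStar g n) : φ.trans ψ ∈ AutStar g n := by
  rw [mem_autStar_iff] at hφ hψ ⊢
  refine ⟨fun x => ?_, fun z w => ?_⟩
  · rw [AddEquiv.trans_apply, hφ.1, hψ.1]
  · rw [AddEquiv.trans_apply, AddEquiv.trans_apply, hψ.2, hφ.2]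

theorem coeff_ringAut (φ : SurfH g n ≃+ SurfH g n) (r : GR g n) (h : SurfH g n) :
    (ringAut φ r).coeff h = r.coeff (φ.symm h) :=
  AddMonoidAlgebra.coeff_domCongr (R := ℤ) φ r h

theorem ringAut_refl (r : GR g n) : ringAut (AddEquiv.refl _) r = r := by
  ext h
  rw [coeff_ringAut]
  rfl

theorem ringAut_trans (φ ψ : SurfH g n ≃+ SurfH g n) (r : GR g n) :
    ringAut (φ.trans ψ) r = ringAut ψ (ringAut φ r) := by
  ext h
  simp only [coeff_ringAut]
  rfl

theorem barR_ringAut (φ : SurfH g n ≃+ SurfH g n) (r : GR g n) :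
    barR g n (ringAut φ r) = ringAut φ (barR g n r) := by
  ext h
  simp only [barR, coeff_ringAut]
  congr 1
  exact map_neg φ.symm h

theorem barR_barR (r : GR g n) : barR g n (barR g n r) = r := by
  ext h
  simp only [barR, coeff_ringAut]
  congr 1
  exact neg_neg h

theorem fieldAut_incl (e : GR g n ≃+* GR g n) (r : GR g n) :
    fieldAut e (incl g n r) = incl g n (e r) :=
  IsFractionRing.ringEquivOfRingEquiv_algebraMap e r

theorem incl_injective : Function.Injective (incl g n) :=
  IsFractionRing.injective (GR g n) (QF g n)

theorem incl_ne_zero {r : GR g n} (hr : r ≠ 0) : incl g n r ≠ 0 :=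
  (map_ne_zero_iff _ incl_injective).mpr hr

theorem doteq_incl_iff {a b : GR g n} : doteq (incl g n a) (incl g n b) ↔ Associated a b := by
  constructor
  · rintro ⟨u, h, hab⟩
    rw [← map_mul] at hab
    rw [incl_injective hab, mul_comm]
    exact associated_mul_unit_left b _ (isUnit_single u h)
  · rintro ⟨w, hw⟩
    obtain ⟨u, h, huh⟩ := AddMonoidAlgebra.exists_eq_single_of_isUnit w⁻¹.isUnit
    refine ⟨u, h, ?_⟩
    rw [← huh, ← map_mul, ← hw, mul_comm, mul_assoc, Units.mul_inv, mul_one]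

theorem sim_incl_iff {a b : GR g n} :
    sim g n (incl g n a) (incl g n b) ↔ ∃ φ ∈ AutStar g n, Associated a (ringAut φ b) := by
  simp only [sim, fieldAut_incl, doteq_incl_iff]

theorem exists_incl_mul_eq (x : QF g n) :
    ∃ a b : GR g n, b ≠ 0 ∧ x * incl g n b = incl g n a := by
  obtain ⟨⟨a, b⟩, h⟩ := IsLocalization.surj (GR g n)⁰ x
  exact ⟨a, b, nonZeroDivisors.ne_zero b.2, h⟩

end AutStar

section Orbits

variable (g n : ℕ)

/-- The relation `∼` on `ℤ[H]`. -/
def orbitSetoid : Setoid (GR g n) where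
  r a b := sim g n (incl g n a) (incl g n b)
  iseqv := by
    refine ⟨fun a => ?_, fun {a b} h => ?_, fun {a b c} h k => ?_⟩
    · exact sim_incl_iff.mpr ⟨_, refl_mem_autStar, by rw [ringAut_refl]⟩
    · obtain ⟨φ, hφ, hab⟩ := sim_incl_iff.mp h
      refine sim_incl_iff.mpr ⟨_, symm_mem_autStar hφ, ?_⟩
      have h1 := hab.symm.map (ringAut φ.symm)
      rwa [← ringAut_trans, AddEquiv.self_trans_symm, ringAut_refl] at h1
    · obtain ⟨φ, hφ, hab⟩ := sim_incl_iff.mp h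
      obtain ⟨ψ, hψ, hbc⟩ := sim_incl_iff.mp k
      refine sim_incl_iff.mpr ⟨_, trans_mem_autStar hψ hφ, hab.trans ?_⟩
      rw [ringAut_trans]
      exact hbc.map (ringAut φ)

/-- The quotient of `ℤ[H]` by `∼`. -/
abbrev Orbit : Type := Quotient (orbitSetoid g n)

/-- The action of the involution on `∼`-classes. -/
def barOrbit : Orbit g n → Orbit g n :=
  Quotient.map (barR g n) fun a b h => by
    obtain ⟨φ, hφ, hab⟩ := sim_incl_iff.mp h
    refine sim_incl_iff.mpr ⟨φ, hφ, ?_⟩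
    rw [← barR_ringAut]
    exact hab.map (barR g n)

variable {g n}

theorem barOrbit_mk (r : GR g n) :
    barOrbit g n (Quotient.mk _ r) = Quotient.mk _ (barR g n r) := rfl

theorem barOrbit_involutive : Function.Involutive (barOrbit g n) := by
  intro c
  induction c using Quotient.inductionOn with
  | h r => rw [barOrbit_mk, barOrbit_mk, barR_barR]

theorem orbit_mk_eq_of_associated {a b : GR g n} (h : Associated a b) :
    (Quotient.mk _ a : Orbit g n) = Quotient.mk _ b :=
  Quotient.sound (sim_incl_iff.mpr ⟨_, refl_mem_autStar, by rwa [ringAut_refl]⟩)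

theorem orbit_mk_ringAut {φ : SurfH g n ≃+ SurfH g n} (hφ : φ ∈ AutStar g n) (r : GR g n) :
    (Quotient.mk _ (ringAut φ r) : Orbit g n) = Quotient.mk _ r :=
  Quotient.sound (sim_incl_iff.mpr ⟨φ, hφ, Associated.refl _⟩)

variable [UniqueFactorizationMonoid (GR g n)]

/-- The multiset of `∼`-classes of the irreducible factors of `r`. -/
def factorOrbits (r : GR g n) : Multiset (Orbit g n) :=
  (factors r).map (Quotient.mk _)

theorem factorOrbits_eq_map {r : GR g n} (hr : r ≠ 0) {s : Multiset (GR g n)}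
    (hs : ∀ x ∈ s, Irreducible x) (h : Associated s.prod r) :
    factorOrbits r = s.map (Quotient.mk _) := by
  have hrel : Multiset.Rel Associated (factors r) s :=
    factors_unique irreducible_of_factor hs ((factors_prod hr).trans h.symm)
  rw [factorOrbits, ← Multiset.rel_eq, Multiset.rel_map]
  exact hrel.mono fun a _ b _ hab => orbit_mk_eq_of_associated hab

theorem factorOrbits_mul {a b : GR g n} (ha : a ≠ 0) (hb : b ≠ 0) :
    factorOrbits (a * b) = factorOrbits a + factorOrbits b := by
  rw [factorOrbits_eq_map (mul_ne_zero ha hb) (s := factors a + factors b), Multiset.map_add]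
  · rfl
  · intro x hx
    rcases Multiset.mem_add.mp hx with h | h <;> exact irreducible_of_factor x h
  · rw [Multiset.prod_add]
    exact (factors_prod ha).mul_mul (factors_prod hb)

theorem factorOrbits_of_isUnit {u : GR g n} (hu : IsUnit u) : factorOrbits u = 0 := by
  rw [factorOrbits_eq_map hu.ne_zero (s := 0) (by simp)]
  · rfl
  · rw [Multiset.prod_zero]
    exact (associated_one_iff_isUnit.mpr hu).symm

theorem factorOrbits_map (e : GR g n ≃+* GR g n) {r : GR g n} (hr : r ≠ 0) :
    factorOrbits (e r) = (factors r).map (fun x => Quotient.mk _ (e x)) := by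
  rw [factorOrbits_eq_map ((map_ne_zero_iff e e.injective).mpr hr) (s := (factors r).map e),
    Multiset.map_map]
  · rfl
  · intro x hx
    obtain ⟨y, hy, rfl⟩ := Multiset.mem_map.mp hx
    exact (MulEquiv.irreducible_iff e).mpr (irreducible_of_factor y hy)
  · rw [← map_multiset_prod]
    exact (factors_prod hr).map e

theorem factorOrbits_ringAut {φ : SurfH g n ≃+ SurfH g n} (hφ : φ ∈ AutStar g n) {r : GR g n}
    (hr : r ≠ 0) : factorOrbits (ringAut φ r) = factorOrbits r := by
  simp only [factorOrbits_map _ hr, orbit_mk_ringAut hφ]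
  rfl

theorem factorOrbits_barR {r : GR g n} (hr : r ≠ 0) :
    factorOrbits (barR g n r) = (factorOrbits r).map (barOrbit g n) := by
  rw [factorOrbits_map _ hr, factorOrbits, Multiset.map_map]
  rfl

theorem exists_irreducible_of_mem_factorOrbits {r : GR g n} {c : Orbit g n}
    (hc : c ∈ factorOrbits r) : ∃ l, Irreducible l ∧ Quotient.mk _ l = c := by
  obtain ⟨l, hl, rfl⟩ := Multiset.mem_map.mp hc
  exact ⟨l, irreducible_of_factor l hl, rfl⟩

open Classical in
theorem eCount_eq_count (l r : GR g n) :
    eCount g n l r = (factorOrbits r).count (Quotient.mk _ l) := by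
  rw [eCount, factorOrbits, Multiset.count_map]
  congr 1
  refine Multiset.filter_congr fun m _ => ?_
  rw [eq_comm, Quotient.eq]
  rfl

theorem factorOrbits_eq_of_mem_AH {x : (QF g n)ˣ} (hx : x ∈ AH g n) :
    ∃ a b : GR g n, a ≠ 0 ∧ b ≠ 0 ∧ (x : QF g n) * incl g n b = incl g n a ∧
      factorOrbits a = factorOrbits b := by
  induction hx using Subgroup.closure_induction with
  | mem x hx =>
    obtain ⟨u, h, p, φ, hφ, hx⟩ := hx
    obtain ⟨c, d, hd, hcd⟩ := exists_incl_mul_eq (p : QF g n)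
    have hc : c ≠ 0 := by
      rintro rfl
      rw [map_zero] at hcd
      exact mul_ne_zero p.ne_zero (incl_ne_zero hd) hcd
    have hφ0 : ∀ {r : GR g n}, r ≠ 0 → ringAut φ r ≠ 0 :=
      fun hr => (map_ne_zero_iff _ (ringAut φ).injective).mpr hr
    have hu := isUnit_single u h
    refine ⟨AddMonoidAlgebra.single h (u : ℤ) * (d * ringAut φ c), c * ringAut φ d,
      mul_ne_zero hu.ne_zero (mul_ne_zero hd (hφ0 hc)), mul_ne_zero hc (hφ0 hd), ?_, ?_⟩
    · have h2 := congrArg (fieldAut (ringAut φ)) hcd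
      rw [map_mul, fieldAut_incl, fieldAut_incl] at h2
      rw [hx, map_mul, map_mul, map_mul, ← h2, ← hcd]
      field_simp
    · rw [factorOrbits_mul hu.ne_zero (mul_ne_zero hd (hφ0 hc)), factorOrbits_of_isUnit hu,
        factorOrbits_mul hd (hφ0 hc), factorOrbits_mul hc (hφ0 hd), factorOrbits_ringAut hφ hc,
        factorOrbits_ringAut hφ hd, zero_add, add_comm]
  | one => exact ⟨1, 1, one_ne_zero, one_ne_zero, by simp, rfl⟩
  | mul x y _ _ hx hy =>
    obtain ⟨a, b, ha, hb, hab, h⟩ := hx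
    obtain ⟨c, d, hc, hd, hcd, k⟩ := hy
    refine ⟨a * c, b * d, mul_ne_zero ha hc, mul_ne_zero hb hd, ?_, ?_⟩
    · rw [Units.val_mul, map_mul, map_mul, ← hab, ← hcd]
      ring
    · rw [factorOrbits_mul ha hc, factorOrbits_mul hb hd, h, k]
  | inv x _ hx =>
    obtain ⟨a, b, ha, hb, hab, h⟩ := hx
    refine ⟨b, a, hb, ha, ?_, h.symm⟩
    rw [← hab, Units.inv_mul_cancel_left]

theorem factorOrbits_add_map_of_mem_Qsym {p : (QF g n)ˣ} (hp : p ∈ Qsym g n) {a b : GR g n}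
    (ha : a ≠ 0) (hb : b ≠ 0) (hab : (p : QF g n) * incl g n b = incl g n a) :
    factorOrbits a + (factorOrbits b).map (barOrbit g n) =
      factorOrbits b + (factorOrbits a).map (barOrbit g n) := by
  obtain ⟨c, d, hc, hd, hcd, h⟩ := factorOrbits_eq_of_mem_AH (Subgroup.mem_comap.mp hp)
  have hbar0 : ∀ {r : GR g n}, r ≠ 0 → barR g n r ≠ 0 :=
    fun hr => (map_ne_zero_iff _ (barR g n).injective).mpr hr
  have hbar := congrArg (barQ g n) hab
  rw [map_mul, barQ, fieldAut_incl, fieldAut_incl, ← barQ] at hbar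
  have hcd' : barQ g n p * incl g n d = p * incl g n c := by
    rw [← hcd]
    simp only [MonoidHom.div_apply, MonoidHom.id_apply, Units.val_div_eq_div_val]
    change _ = (p : QF g n) * (barQ g n p / p * _)
    field_simp
  have hmul : barR g n a * b * d = barR g n b * a * c := by
    apply incl_injective
    simp only [map_mul]
    rw [← hbar, ← hab]
    linear_combination (incl g n (barR g n b) * incl g n b) * hcd'
  have h2 := congrArg factorOrbits hmul
  rw [factorOrbits_mul (mul_ne_zero (hbar0 ha) hb) hd, factorOrbits_mul (hbar0 ha) hb,
    factorOrbits_mul (mul_ne_zero (hbar0 hb) ha) hc, factorOrbits_mul (hbar0 hb) ha, h,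
    factorOrbits_barR ha, factorOrbits_barR hb] at h2
  rw [add_comm, ← add_right_cancel h2, add_comm]

end Orbits

section QuotientClass

variable {g n : ℕ}

variable (g n) in
/-- The quotient group `Q(H)^× / A(H)N(H)`. -/
def NormQuotient : Type := (QF g n)ˣ ⧸ (AH g n ⊔ NH g n)

instance : CommGroup (NormQuotient g n) :=
  inferInstanceAs (CommGroup ((QF g n)ˣ ⧸ (AH g n ⊔ NH g n)))

variable (g n) in
/-- The projection `Q(H)^× → Q(H)^× / A(H)N(H)`. -/
def normMk : (QF g n)ˣ →* NormQuotient g n := QuotientGroup.mk' (AH g n ⊔ NH g n)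

theorem normMk_eq_one_iff {x : (QF g n)ˣ} : normMk g n x = 1 ↔ x ∈ AH g n ⊔ NH g n :=
  QuotientGroup.eq_one_iff x

theorem normMk_eq_iff {x y : (QF g n)ˣ} :
    normMk g n x = normMk g n y ↔ x⁻¹ * y ∈ AH g n ⊔ NH g n :=
  QuotientGroup.eq

/-- The class of `r ∈ ℤ[H]` in `Q(H)^× / A(H)N(H)`, with value `1` at `r = 0`. -/
def normClass (r : GR g n) : NormQuotient g n :=
  open Classical in
  if hr : r = 0 then 1 else normMk g n (Units.mk0 (incl g n r) (incl_ne_zero hr))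

theorem normClass_of_ne_zero {r : GR g n} (hr : r ≠ 0) :
    normClass r = normMk g n (Units.mk0 (incl g n r) (incl_ne_zero hr)) :=
  dif_neg hr

theorem normClass_zero : normClass (0 : GR g n) = 1 := dif_pos rfl

theorem normClass_one : normClass (1 : GR g n) = 1 := by
  rw [normClass_of_ne_zero one_ne_zero, ← map_one (normMk g n)]
  congr 1
  ext
  simp

theorem normClass_mul {a b : GR g n} (ha : a ≠ 0) (hb : b ≠ 0) :
    normClass (a * b) = normClass a * normClass b := by
  rw [normClass_of_ne_zero ha, normClass_of_ne_zero hb, normClass_of_ne_zero (mul_ne_zero ha hb),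
    ← map_mul]
  congr 1
  ext
  simp

theorem normClass_eq_of_sim {a b : GR g n} (h : sim g n (incl g n a) (incl g n b)) :
    normClass a = normClass b := by
  obtain ⟨φ, hφ, u, x, hux⟩ := h
  have hu := incl_ne_zero (isUnit_single u x).ne_zero
  have hab : a = 0 ↔ b = 0 := by
    rw [← map_eq_zero_iff _ incl_injective, hux, mul_eq_zero, or_iff_right hu,
      map_eq_zero_iff _ (RingEquiv.injective _), map_eq_zero_iff _ incl_injective]
  by_cases ha : a = 0
  · rw [ha, hab.mp ha]
  · have hb := mt hab.mpr ha
    rw [normClass_of_ne_zero ha, normClass_of_ne_zero hb, eq_comm, normMk_eq_iff]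
    refine Subgroup.mem_sup_left (Subgroup.subset_closure
      ⟨u, x, Units.mk0 _ (incl_ne_zero hb), φ, hφ, ?_⟩)
    simp only [Units.val_mul, Units.val_inv_eq_inv_val, Units.val_mk0, hux]
    ring

theorem normClass_mul_barR (r : GR g n) : normClass r * normClass (barR g n r) = 1 := by
  by_cases hr : r = 0
  · rw [hr, map_zero, normClass_zero, mul_one]
  · have hr' : barR g n r ≠ 0 := (map_ne_zero_iff _ (barR g n).injective).mpr hr
    rw [normClass_of_ne_zero hr, normClass_of_ne_zero hr', ← map_mul,
      normMk_eq_one_iff]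
    refine Subgroup.mem_sup_right (Subgroup.subset_closure
      ⟨1, 0, Units.mk0 _ (incl_ne_zero hr), ?_⟩)
    simp only [Units.val_mul, Units.val_mk0, barQ, fieldAut_incl, Units.val_one]
    rw [← AddMonoidAlgebra.one_def, map_one, one_mul]

variable (g n) in
/-- The class in `Q(H)^× / A(H)N(H)` of a `∼`-class. -/
def orbitClass : Orbit g n → NormQuotient g n :=
  Quotient.lift normClass fun _ _ h => normClass_eq_of_sim h

theorem orbitClass_mul_barOrbit (c : Orbit g n) :
    orbitClass g n c * orbitClass g n (barOrbit g n c) = 1 := by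
  induction c using Quotient.inductionOn with
  | h r => exact normClass_mul_barR r

theorem normClass_multiset_prod (s : Multiset (GR g n)) (hs : (0 : GR g n) ∉ s) :
    normClass s.prod = (s.map normClass).prod := by
  induction s using Multiset.induction with
  | empty => exact normClass_one
  | cons a s ih =>
    rw [Multiset.mem_cons, not_or] at hs
    rw [Multiset.prod_cons, normClass_mul (Ne.symm hs.1) (Multiset.prod_ne_zero hs.2), ih hs.2,
      Multiset.map_cons, Multiset.prod_cons]

theorem prod_orbitClass_factorOrbits [UniqueFactorizationMonoid (GR g n)] {r : GR g n}
    (hr : r ≠ 0) : ((factorOrbits r).map (orbitClass g n)).prod = normClass r := by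
  rw [factorOrbits, Multiset.map_map]
  change ((factors r).map normClass).prod = _
  rw [← normClass_multiset_prod _ fun h => not_irreducible_zero (irreducible_of_factor 0 h)]
  exact congrArg (orbitClass g n) (orbit_mk_eq_of_associated (factors_prod hr))

end QuotientClass

/-- If `f (σ c) = (f c)⁻¹` for an involution `σ`, and two multisets have multiplicities differing
by a `σ`-invariant function that is even at the fixed points of `σ`, then `f` has the same product
over both. -/
theorem Multiset.prod_map_eq_of_involutive {C M : Type*} [DecidableEq C] [CommGroup M]
    {σ : C → C} (hσ : Function.Involutive σ) {f : C → M} (hf : ∀ c, f c * f (σ c) = 1)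
    {S T : Multiset C} (hST : S + T.map σ = T + S.map σ)
    (heven : ∀ c, c ∈ S + T → σ c = c → Even ((S.count c : ℤ) - T.count c)) :
    (S.map f).prod = (T.map f).prod := by
  have hcount : ∀ (R : Multiset C) (c : C), (R.map σ).count (σ c) = R.count c :=
    fun R c => Multiset.count_map_eq_count' σ R hσ.injective c
  have hcount' : ∀ (R : Multiset C) (c : C), (R.map σ).count c = R.count (σ c) := by
    intro R c
    rw [← hcount R (σ c), hσ c]
  set d : C → ℤ := fun c => (S.count c : ℤ) - T.count c with hd
  have hdσ : ∀ c, d (σ c) = d c := by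
    intro c
    have h := congrArg (Multiset.count c) hST
    rw [Multiset.count_add, Multiset.count_add, hcount', hcount'] at h
    simp only [hd]
    omega
  set U : Finset C := (S + T + (S + T).map σ).toFinset with hU
  have hprod : ∀ R : Multiset C, R ≤ S + T → (R.map f).prod = ∏ c ∈ U, f c ^ R.count c := by
    intro R hR
    rw [Finset.prod_multiset_map_count]
    refine Finset.prod_subset (fun c hc => ?_) fun c _ hc => ?_
    · rw [Multiset.mem_toFinset] at hc ⊢
      exact Multiset.mem_add.mpr (Or.inl (Multiset.mem_of_le hR hc))
    · rw [Multiset.mem_toFinset] at hc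
      rw [Multiset.count_eq_zero_of_notMem hc, pow_zero]
  rw [← div_eq_one, hprod S (Multiset.le_add_right S T), hprod T (Multiset.le_add_left T S),
    ← Finset.prod_div_distrib]
  have hpow : ∀ c, f c ^ S.count c / f c ^ T.count c = f c ^ d c := by
    intro c
    rw [hd, zpow_sub, zpow_natCast, zpow_natCast, div_eq_mul_inv]
  simp only [hpow]
  refine Finset.prod_involution (fun c _ => σ c) (fun c _ => ?_) (fun c _ hc hfix => hc ?_)
    (fun c hc => ?_) (fun c _ => hσ c)
  · rw [hdσ, ← mul_zpow, hf, one_zpow]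
  · by_cases hmem : c ∈ S + T
    · obtain ⟨k, hk⟩ := heven c hmem hfix
      have h2 := hf c
      rw [hfix] at h2
      change f c ^ ((S.count c : ℤ) - T.count c) = 1
      rw [hk, zpow_add, ← mul_zpow, h2, one_zpow]
    · rw [Multiset.mem_add, not_or] at hmem
      simp [hd, Multiset.count_eq_zero_of_notMem hmem.1, Multiset.count_eq_zero_of_notMem hmem.2]
  · rw [hU, Multiset.mem_toFinset, Multiset.mem_add] at hc ⊢
    rcases hc with h | h
    · exact Or.inr (Multiset.mem_map_of_mem σ h)
    · obtain ⟨x, hx, rfl⟩ := Multiset.mem_map.mp h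
      rw [hσ x]
      exact Or.inl hx

/-- **Injectivity of `Ψ` in Proposition 5.1 (1).**
If `p ∈ Q(H)^{sym}` and `e_λ(p)` is even for every self-dual irreducible `λ ∈ ℤ[H]`,
then `p ∈ A(H)N(H)`. -/
theorem torsion_psi_injective
    (g n : ℕ) (hH : 1 ≤ (n - 1) + 2 * g)
    [UniqueFactorizationMonoid (GR g n)]
    (p : (QF g n)ˣ) (hp : p ∈ Qsym g n)
    (heven : ∀ l : GR g n, Irreducible l →
      sim g n (incl g n l) (incl g n (barR g n l)) →
      Even (eOrb g n l (p : QF g n))) :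
    p ∈ AH g n ⊔ NH g n := by
  classical
  set a : GR g n := (IsLocalization.sec (GR g n)⁰ (p : QF g n)).1 with ha_def
  set b : GR g n := ((IsLocalization.sec (GR g n)⁰ (p : QF g n)).2 : GR g n) with hb_def
  have hab : (p : QF g n) * incl g n b = incl g n a :=
    IsLocalization.sec_spec (GR g n)⁰ (p : QF g n)
  have hb : b ≠ 0 := nonZeroDivisors.ne_zero (SetLike.coe_mem _)
  have ha : a ≠ 0 := by
    intro h
    rw [h, map_zero] at hab
    exact mul_ne_zero p.ne_zero (incl_ne_zero hb) hab
  have hclass : normClass a = normClass b := by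
    rw [← prod_orbitClass_factorOrbits ha, ← prod_orbitClass_factorOrbits hb]
    refine Multiset.prod_map_eq_of_involutive barOrbit_involutive orbitClass_mul_barOrbit
      (factorOrbits_add_map_of_mem_Qsym hp ha hb hab) fun c hc hfix => ?_
    obtain ⟨l, hl, rfl⟩ : ∃ l, Irreducible l ∧ Quotient.mk _ l = c := by
      rcases Multiset.mem_add.mp hc with h | h <;> exact exists_irreducible_of_mem_factorOrbits h
    have h := heven l hl (Quotient.exact hfix.symm)
    rwa [eOrb, ← ha_def, ← hb_def, eCount_eq_count, eCount_eq_count] at h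
  rw [← normMk_eq_one_iff]
  have hpb : p * Units.mk0 _ (incl_ne_zero hb) = Units.mk0 _ (incl_ne_zero ha) :=
    Units.ext hab
  rw [normClass_of_ne_zero ha, normClass_of_ne_zero hb, ← hpb, map_mul] at hclass
  exact mul_eq_right.mp hclass
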